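/- Let the p-adic digits a, b, c, d, g, h, k, l, m, n, r ∈ {0,…,p−1} be such that a, b, c are pairwise distinct, and set α_1 = a + dp + kp^2, α_2 = a + dp + lp^2 with k ≠ l, α_3 = b + gp + mp^2, α_4 = c + hp + np^2, α_5 = c + hp + rp^2 with n ≠ r. For f(x) = (x−α_1)(x−α_2)^3(x−α_3)(x−α_4)^2(x−α_5), the Igusa zeta function equals Z(s,f) = p^{−1}(p−3) + (1−p^{−1})p^{−1−s}/(1−p^{−1−s}) + p^{−1}(p−1)p^{−1−4s} + p^{−1}(p−1)p^{−1−3s} + p^{−1}(p−2)p^{−2−8s} + (1−p^{−1})p^{−3−9s}/(1−p^{−1−s}) + (1−p^{−1})p^{−3−11s}/(1−p^{−1−3s}) + p^{−1}(p−2)p^{−2−6s} + (1−p^{−1})p^{−3−7s}/(1−p^{−1−s}) + (1−p^{−1})p^{−3−8s}/(1−p^{−1−2s}). -/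

import Mathlib

open MeasureTheory

noncomputable instance {p : ℕ} [Fact p.Prime] : MeasurableSpace ℤ_[p] := borel _
instance {p : ℕ} [Fact p.Prime] : BorelSpace ℤ_[p] := ⟨rfl⟩

open Metric

namespace PadicInt

variable {p : ℕ} [Fact p.Prime]

lemma inv_prime_pos : (0 : ℝ) < (p : ℝ)⁻¹ :=
  inv_pos.2 (Nat.cast_pos.2 (Fact.out : p.Prime).pos)

lemma inv_prime_lt_one : (p : ℝ)⁻¹ < 1 :=
  inv_lt_one_of_one_lt₀ (Nat.one_lt_cast.2 (Fact.out : p.Prime).one_lt)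

lemma inv_prime_pow_lt {m n : ℕ} (h : m < n) : ((p : ℝ)⁻¹) ^ n < ((p : ℝ)⁻¹) ^ m :=
  pow_lt_pow_right_of_lt_one₀ inv_prime_pos inv_prime_lt_one h

/-- The norm on `ℤ_[p]` takes no values strictly between consecutive powers of `p⁻¹`. -/
lemma norm_eq_inv_pow {x : ℤ_[p]} {n : ℕ} (h₁ : ‖x‖ ≤ ((p : ℝ)⁻¹) ^ n)
    (h₂ : ¬ ‖x‖ ≤ ((p : ℝ)⁻¹) ^ (n + 1)) : ‖x‖ = ((p : ℝ)⁻¹) ^ n := by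
  refine le_antisymm h₁ (not_lt.1 fun h ↦ h₂ ?_)
  have := (norm_lt_pow_iff_norm_le_pow_sub_one x (-n)).1 (by simpa using h)
  rw [show (-(n : ℤ) - 1) = -((n + 1 : ℕ) : ℤ) by push_cast; ring, zpow_neg, zpow_natCast,
    ← inv_pow] at this
  exact this

lemma norm_sub_eq_of_lt {x α β : ℤ_[p]} (h : ‖x - α‖ < ‖α - β‖) : ‖x - β‖ = ‖α - β‖ := by
  rw [← sub_add_sub_cancel x α β, norm_add_eq_max_of_ne h.ne, max_eq_right h.le]

lemma norm_sub_eq_of_gt {x α β : ℤ_[p]} (h : ‖α - β‖ < ‖x - α‖) : ‖x - β‖ = ‖x - α‖ := by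
  rw [← sub_add_sub_cancel x α β, norm_add_eq_max_of_ne h.ne', max_eq_left h.le]

lemma norm_natCast_sub_natCast_of_lt {a b : ℕ} (ha : a < p) (hb : b < p) (h : a ≠ b) :
    ‖(a : ℤ_[p]) - b‖ = 1 := by
  have : ‖(((a : ℤ) - b : ℤ) : ℤ_[p])‖ = 1 := by
    refine le_antisymm (norm_le_one _) (not_lt.1 fun h' ↦ h ?_)
    have := Int.eq_zero_of_abs_lt_dvd ((norm_int_lt_one_iff_dvd _).1 h')
      (abs_lt.2 ⟨by lia, by lia⟩)
    lia
  simpa using this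

/-- Elements of `ℤ_[p]` with distinct leading digits are at distance one. -/
lemma norm_sub_eq_one_of_digit_ne {a b : ℕ} (ha : a < p) (hb : b < p) (h : a ≠ b)
    (u v : ℤ_[p]) : ‖(a + p * u) - (b + p * v)‖ = 1 := by
  have h₁ : ‖(p : ℤ_[p]) * (u - v)‖ < 1 := by
    rw [norm_mul, norm_p]
    exact (mul_le_of_le_one_right inv_prime_pos.le (norm_le_one _)).trans_lt inv_prime_lt_one
  have h₂ := norm_natCast_sub_natCast_of_lt ha hb h
  rw [show (a + p * u) - (b + p * v) = ((a : ℤ_[p]) - b) + p * (u - v) by ring,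
    norm_add_eq_max_of_ne (by rw [h₂]; exact h₁.ne'), h₂, max_eq_left h₁.le]

lemma coe_ker_toZModPow (n : ℕ) :
    ((toZModPow n : ℤ_[p] →+* ZMod (p ^ n)).toAddMonoidHom.ker : Set ℤ_[p]) =
      closedBall 0 (((p : ℝ)⁻¹) ^ n) := by
  ext x
  have : x ∈ RingHom.ker (toZModPow n : ℤ_[p] →+* ZMod (p ^ n)) ↔ ‖x‖ ≤ ((p : ℝ)⁻¹) ^ n := by
    rw [ker_toZModPow, ← norm_le_pow_iff_mem_span_pow, zpow_neg, zpow_natCast, inv_pow]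
  simpa [RingHom.mem_ker, AddMonoidHom.mem_ker] using this

variable (μ : Measure ℤ_[p])

lemma measureReal_closedBall [μ.IsAddHaarMeasure] (hμ : μ Set.univ = 1) (x : ℤ_[p]) (n : ℕ) :
    μ.real (closedBall x (((p : ℝ)⁻¹) ^ n)) = ((p : ℝ)⁻¹) ^ n := by
  have : NeZero (p ^ n) := ⟨pow_ne_zero _ (Fact.out : p.Prime).ne_zero⟩
  set H := (toZModPow n : ℤ_[p] →+* ZMod (p ^ n)).toAddMonoidHom.ker
  have hindex : H.index = p ^ n := by
    have hsurj : Function.Surjective (toZModPow n : ℤ_[p] →+* ZMod (p ^ n)).toAddMonoidHom :=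
      ZMod.ringHom_surjective (toZModPow n : ℤ_[p] →+* ZMod (p ^ n))
    rw [AddSubgroup.index_ker, AddMonoidHom.range_eq_top.2 hsurj]
    simp
  have : H.FiniteIndex := ⟨by rw [hindex]; exact NeZero.ne _⟩
  have hball : (H : Set ℤ_[p]) = closedBall 0 (((p : ℝ)⁻¹) ^ n) := coe_ker_toZModPow n
  have h := AddSubgroup.index_mul_measure H (hball ▸ measurableSet_closedBall) μ
  have hx : μ (closedBall x (((p : ℝ)⁻¹) ^ n)) = μ (closedBall 0 (((p : ℝ)⁻¹) ^ n)) := by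
    rw [← measure_preimage_add μ (-x) (closedBall 0 _)]
    congr 1
    ext y
    simp [dist_eq_norm, neg_add_eq_sub]
  rw [hball, ← hx, hindex, hμ] at h
  have h' := congrArg ENNReal.toReal h
  rw [ENNReal.toReal_mul, ENNReal.toReal_natCast, ENNReal.toReal_one, Nat.cast_pow] at h'
  rw [measureReal_def, eq_inv_of_mul_eq_one_right h', inv_pow]

variable {φ : ℤ_[p] → ℝ} {s : ℂ}

lemma integrable_cpow [IsFiniteMeasure μ] (hφ : Continuous φ) (hs : 0 < s.re) :
    Integrable (fun x ↦ (φ x : ℂ) ^ s) μ :=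
  ((Complex.continuous_ofReal_cpow_const hs).comp hφ).integrable_of_hasCompactSupport
    (HasCompactSupport.of_compactSpace _)

lemma ofReal_inv_pow_cpow (n : ℕ) :
    (((((p : ℝ)⁻¹) ^ n : ℝ) : ℝ) : ℂ) ^ s = ((p : ℂ) ^ (-s)) ^ n := by
  have : (((p : ℝ)⁻¹ : ℝ) : ℂ) ^ s = (p : ℂ) ^ (-s) := by
    rw [Complex.ofReal_inv, Complex.ofReal_natCast, Complex.inv_cpow, Complex.cpow_neg]
    rw [Complex.natCast_arg]
    exact Real.pi_pos.ne
  rw [← this]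
  induction n with
  | zero => simp
  | succ n ih =>
    rw [pow_succ, Complex.ofReal_mul,
      Complex.mul_cpow_ofReal_nonneg (pow_nonneg inv_prime_pos.le _) inv_prime_pos.le, ih, pow_succ]

/-- Splitting off from an integral over `S` the part outside `T ⊆ S`, where the integrand is
constant. -/
lemma setIntegral_cpow_eq_add [IsFiniteMeasure μ] (hφ : Continuous φ) (hs : 0 < s.re)
    {S T : Set ℤ_[p]} (hS : MeasurableSet S) (hT : MeasurableSet T) (hTS : T ⊆ S) {e : ℕ}
    (h : ∀ x ∈ S, x ∉ T → φ x = ((p : ℝ)⁻¹) ^ e) :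
    ∫ x in S, (φ x : ℂ) ^ s ∂μ =
      ((μ.real S - μ.real T : ℝ) : ℂ) * ((p : ℂ) ^ (-s)) ^ e + ∫ x in T, (φ x : ℂ) ^ s ∂μ := by
  have hc : ∫ x in S \ T, (φ x : ℂ) ^ s ∂μ =
      ((μ.real S - μ.real T : ℝ) : ℂ) * ((p : ℂ) ^ (-s)) ^ e := by
    rw [setIntegral_congr_fun (g := fun _ ↦ ((p : ℂ) ^ (-s)) ^ e) (hS.diff hT)
      fun x hx ↦ by simp only [h x hx.1 hx.2, ofReal_inv_pow_cpow], setIntegral_const,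
      measureReal_sdiff hTS hT, Complex.real_smul]
  rw [← hc, setIntegral_sdiff hT (integrable_cpow μ hφ hs).integrableOn hTS, sub_add_cancel]

lemma norm_prime_cpow_neg_lt_one (hs : 0 < s.re) : ‖(p : ℂ) ^ (-s)‖ < 1 := by
  rw [Complex.norm_natCast_cpow_of_pos (Fact.out : p.Prime).pos]
  exact Real.rpow_lt_one_of_one_lt_of_neg (Nat.one_lt_cast.2 (Fact.out : p.Prime).one_lt) (by simpa)

lemma norm_inv_mul_cpow_pow_lt_one (hs : 0 < s.re) (M : ℕ) :
    ‖(p : ℂ)⁻¹ * ((p : ℂ) ^ (-s)) ^ M‖ < 1 := by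
  rw [norm_mul, norm_inv, Complex.norm_natCast, norm_pow]
  exact (mul_le_of_le_one_right inv_prime_pos.le
    (pow_le_one₀ (norm_nonneg _) (norm_prime_cpow_neg_lt_one hs).le)).trans_lt inv_prime_lt_one

/-- The local zeta integral over a ball containing a single zero, of multiplicity `M`. -/
lemma setIntegral_closedBall_cpow [μ.IsAddHaarMeasure] (hμ : μ Set.univ = 1)
    (hφ : Continuous φ) (hs : 0 < s.re) {α : ℤ_[p]} {j C M : ℕ}
    (h : ∀ x ∈ closedBall α (((p : ℝ)⁻¹) ^ j), φ x = ((p : ℝ)⁻¹) ^ C * ‖x - α‖ ^ M) :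
    ∫ x in closedBall α (((p : ℝ)⁻¹) ^ j), (φ x : ℂ) ^ s ∂μ =
      ((p : ℂ) ^ (-s)) ^ C * (1 - (p : ℂ)⁻¹) * ((p : ℂ)⁻¹ * ((p : ℂ) ^ (-s)) ^ M) ^ j /
        (1 - (p : ℂ)⁻¹ * ((p : ℂ) ^ (-s)) ^ M) := by
  have hfin : IsFiniteMeasure μ := ⟨by simp [hμ]⟩
  set t := (p : ℂ) ^ (-s) with ht
  set w := (p : ℂ)⁻¹ * t ^ M with hw
  have hw1 : ‖w‖ < 1 := norm_inv_mul_cpow_pow_lt_one hs M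
  have hw0 : 1 - w ≠ 0 := fun h0 ↦ by simp [← sub_eq_zero.1 h0] at hw1
  let I (i : ℕ) : ℂ := ∫ x in closedBall α (((p : ℝ)⁻¹) ^ (j + i)), (φ x : ℂ) ^ s ∂μ
  let E (i : ℕ) : ℂ := t ^ C * (1 - (p : ℂ)⁻¹) * w ^ (j + i) / (1 - w)
  have hsub (i : ℕ) : closedBall α (((p : ℝ)⁻¹) ^ (j + i)) ⊆ closedBall α (((p : ℝ)⁻¹) ^ j) :=
    closedBall_subset_closedBall
      (pow_le_pow_of_le_one inv_prime_pos.le inv_prime_lt_one.le (Nat.le_add_right _ _))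
  have hrec (i : ℕ) : I i - E i = I (i + 1) - E (i + 1) := by
    have hI : I i = _ := setIntegral_cpow_eq_add μ hφ hs (e := C + (j + i) * M)
      measurableSet_closedBall measurableSet_closedBall
      (closedBall_subset_closedBall (inv_prime_pow_lt (Nat.lt_add_one (j + i))).le)
      fun x hx hx' ↦ by
        rw [h x (hsub i hx), pow_add, pow_mul]
        rw [mem_closedBall, dist_eq_norm] at hx hx'
        rw [norm_eq_inv_pow hx hx']
    rw [measureReal_closedBall μ hμ, measureReal_closedBall μ hμ, ← ht] at hI
    have hE : E i = t ^ C * (1 - (p : ℂ)⁻¹) * w ^ (j + i) + E (i + 1) := by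
      simp only [E, ← add_assoc, pow_succ]
      field_simp
      ring
    rw [hI, hE]
    change _ + I (i + 1) - _ = _
    have hwp : w ^ (j + i) = ((p : ℂ)⁻¹) ^ (j + i) * t ^ ((j + i) * M) := by
      rw [hw, mul_pow, ← pow_mul, mul_comm M]
    rw [hwp]
    push_cast
    ring
  have hconst (i : ℕ) : I i - E i = I 0 - E 0 := by
    induction i with
    | zero => rfl
    | succ i ih => rw [← hrec, ih]
  have hE0 : Filter.Tendsto E Filter.atTop (nhds 0) := by
    have := ((tendsto_pow_atTop_nhds_zero_of_norm_lt_one hw1).const_mul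
      (t ^ C * (1 - (p : ℂ)⁻¹) * w ^ j / (1 - w)))
    rw [mul_zero] at this
    refine this.congr fun i ↦ ?_
    simp only [E, pow_add]
    ring
  have hI0 : Filter.Tendsto I Filter.atTop (nhds 0) := by
    refine squeeze_zero_norm (a := fun i ↦ ((p : ℝ)⁻¹) ^ (j + i)) (fun i ↦ ?_) ?_
    · have := norm_setIntegral_le_of_norm_le_const (μ := μ) (C := 1)
        (s := closedBall α (((p : ℝ)⁻¹) ^ (j + i))) (f := fun x ↦ (φ x : ℂ) ^ s)
        (measure_lt_top _ _) fun x hx ↦ by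
          have h0 : 0 ≤ φ x := by
            rw [h x (hsub i hx)]
            exact mul_nonneg (pow_nonneg inv_prime_pos.le _) (pow_nonneg (norm_nonneg _) _)
          have h1 : φ x ≤ 1 := by
            rw [h x (hsub i hx)]
            exact mul_le_one₀ (pow_le_one₀ inv_prime_pos.le inv_prime_lt_one.le)
              (pow_nonneg (norm_nonneg _) _) (pow_le_one₀ (norm_nonneg _) (norm_le_one _))
          rw [Complex.norm_cpow_eq_rpow_re_of_nonneg h0 hs.ne']
          exact Real.rpow_le_one h0 h1 hs.le
      rwa [one_mul, measureReal_closedBall μ hμ] at this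
    · have := (tendsto_pow_atTop_nhds_zero_of_lt_one (inv_prime_pos (p := p)).le
        inv_prime_lt_one).const_mul (((p : ℝ)⁻¹) ^ j)
      simpa [pow_add] using this
  have hlim := hI0.sub hE0
  simp only [hconst, sub_zero] at hlim
  exact sub_eq_zero.1 (tendsto_nhds_unique tendsto_const_nhds hlim)

lemma disjoint_closedBall_of_lt {α β : ℤ_[p]} {ε : ℝ} (h : ε < ‖α - β‖) :
    Disjoint (closedBall α ε) (closedBall β ε) := by
  refine Set.disjoint_left.2 fun x hx hx' ↦ ?_
  rw [mem_closedBall, dist_eq_norm] at hx hx'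
  rw [norm_sub_eq_of_lt (hx.trans_lt h)] at hx'
  exact hx'.not_gt h

/-- The local zeta integral over a residue class containing two zeros at distance `p⁻²`, of
multiplicities `i` and `j`. -/
lemma setIntegral_closedBall_cpow_of_pair [μ.IsAddHaarMeasure] (hμ : μ Set.univ = 1)
    (hφ : Continuous φ) (hs : 0 < s.re) {α β : ℤ_[p]} {i j : ℕ}
    (hαβ : ‖α - β‖ = ((p : ℝ)⁻¹) ^ 2)
    (h : ∀ x ∈ closedBall α (((p : ℝ)⁻¹) ^ 1), φ x = ‖x - α‖ ^ i * ‖x - β‖ ^ j) :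
    ∫ x in closedBall α (((p : ℝ)⁻¹) ^ 1), (φ x : ℂ) ^ s ∂μ =
      ((p : ℂ)⁻¹ - (p : ℂ)⁻¹ ^ 2) * ((p : ℂ) ^ (-s)) ^ (i + j) +
      ((p : ℂ)⁻¹ ^ 2 - 2 * (p : ℂ)⁻¹ ^ 3) * ((p : ℂ) ^ (-s)) ^ (2 * (i + j)) +
      ((p : ℂ) ^ (-s)) ^ (2 * j) * (1 - (p : ℂ)⁻¹) * ((p : ℂ)⁻¹ * ((p : ℂ) ^ (-s)) ^ i) ^ 3 /
        (1 - (p : ℂ)⁻¹ * ((p : ℂ) ^ (-s)) ^ i) +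
      ((p : ℂ) ^ (-s)) ^ (2 * i) * (1 - (p : ℂ)⁻¹) * ((p : ℂ)⁻¹ * ((p : ℂ) ^ (-s)) ^ j) ^ 3 /
        (1 - (p : ℂ)⁻¹ * ((p : ℂ) ^ (-s)) ^ j) := by
  have hfin : IsFiniteMeasure μ := ⟨by simp [hμ]⟩
  have hβα : ‖β - α‖ = ((p : ℝ)⁻¹) ^ 2 := by rw [norm_sub_rev, hαβ]
  have h21 : closedBall α (((p : ℝ)⁻¹) ^ 2) ⊆ closedBall α (((p : ℝ)⁻¹) ^ 1) :=
    closedBall_subset_closedBall (inv_prime_pow_lt one_lt_two).le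
  have hα32 : closedBall α (((p : ℝ)⁻¹) ^ 3) ⊆ closedBall α (((p : ℝ)⁻¹) ^ 2) :=
    closedBall_subset_closedBall (inv_prime_pow_lt (by norm_num)).le
  have hβ32 : closedBall β (((p : ℝ)⁻¹) ^ 3) ⊆ closedBall α (((p : ℝ)⁻¹) ^ 2) := fun x hx ↦ by
    rw [mem_closedBall, dist_eq_norm] at hx ⊢
    rw [norm_sub_eq_of_lt (hβα ▸ hx.trans_lt (inv_prime_pow_lt (by norm_num))), hβα]
  have hdisj : Disjoint (closedBall α (((p : ℝ)⁻¹) ^ 3)) (closedBall β (((p : ℝ)⁻¹) ^ 3)) :=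
    disjoint_closedBall_of_lt (hαβ ▸ inv_prime_pow_lt (by norm_num))
  rw [setIntegral_cpow_eq_add μ hφ hs (e := i + j) measurableSet_closedBall
      measurableSet_closedBall h21 fun x hx hx' ↦ ?_,
    setIntegral_cpow_eq_add μ hφ hs (e := 2 * (i + j)) measurableSet_closedBall
      (measurableSet_closedBall.union measurableSet_closedBall) (Set.union_subset hα32 hβ32)
      fun x hx hx' ↦ ?_,
    setIntegral_union hdisj measurableSet_closedBall (integrable_cpow μ hφ hs).integrableOn
      (integrable_cpow μ hφ hs).integrableOn,
    setIntegral_closedBall_cpow μ hμ hφ hs (C := 2 * j) (M := i) fun x hx ↦ ?_,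
    setIntegral_closedBall_cpow μ hμ hφ hs (C := 2 * i) (M := j) fun x hx ↦ ?_,
    measureReal_union hdisj measurableSet_closedBall]
  · simp only [measureReal_closedBall μ hμ]
    push_cast
    ring
  · rw [h x (h21 (hβ32 hx))]
    rw [mem_closedBall, dist_eq_norm] at hx
    rw [norm_sub_eq_of_lt (hβα ▸ hx.trans_lt (inv_prime_pow_lt (by norm_num))), hβα, pow_mul]
  · rw [h x (h21 (hα32 hx))]
    rw [mem_closedBall, dist_eq_norm] at hx
    rw [norm_sub_eq_of_lt (α := α) (β := β) (hαβ ▸ hx.trans_lt (inv_prime_pow_lt (by norm_num))),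
      hαβ, pow_mul, mul_comm]
  · rw [h x (h21 hx)]
    rw [Set.mem_union, not_or, mem_closedBall, mem_closedBall, dist_eq_norm, dist_eq_norm] at hx'
    rw [mem_closedBall, dist_eq_norm] at hx
    have hxβ : ‖x - β‖ ≤ ((p : ℝ)⁻¹) ^ 2 := by
      rw [← sub_add_sub_cancel x α β]
      exact (nonarchimedean _ _).trans (max_le hx hαβ.le)
    rw [norm_eq_inv_pow hx hx'.1, norm_eq_inv_pow hxβ hx'.2, ← pow_add, ← pow_mul]
  · rw [h x hx]
    rw [mem_closedBall, dist_eq_norm] at hx hx'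
    have hxα := norm_eq_inv_pow hx hx'
    rw [norm_sub_eq_of_gt (x := x) (α := α) (β := β)
      (by rw [hαβ, hxα]; exact inv_prime_pow_lt one_lt_two), hxα, pow_one, pow_add]

lemma prime_cpow_neg_sub (A B : ℕ) :
    (p : ℂ) ^ (-(A : ℂ) - B * s) = (p : ℂ)⁻¹ ^ A * ((p : ℂ) ^ (-s)) ^ B := by
  have hp : (p : ℂ) ≠ 0 := Nat.cast_ne_zero.2 (Fact.out : p.Prime).ne_zero
  rw [show -(A : ℂ) - B * s = -(A : ℂ) + B * -s by ring, Complex.cpow_add _ _ hp,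
    Complex.cpow_nat_mul, Complex.cpow_neg, Complex.cpow_natCast, inv_pow]

end PadicInt

open PadicInt

/-- The explicit Igusa zeta function of
`f(x) = (x-α₁)(x-α₂)³(x-α₃)(x-α₄)²(x-α₅)` where
`α₁ = a + dp + kp²`, `α₂ = a + dp + lp²`, `α₃ = b + gp + mp²`,
`α₄ = c + hp + np²`, `α₅ = c + hp + rp²` with `a, b, c` pairwise distinct digits,
`k ≠ l` and `n ≠ r`. -/
theorem zeta_example (p : ℕ) [Fact p.Prime]
    (μ : Measure ℤ_[p]) [μ.IsAddHaarMeasure] (hμ : μ Set.univ = 1)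
    (a b c d g h k l m n r : ℕ)
    (hap : a < p) (hbp : b < p) (hcp : c < p) (hdp : d < p) (hgp : g < p) (hhp : h < p)
    (hkp : k < p) (hlp : l < p) (hmp : m < p) (hnp : n < p) (hrp : r < p)
    (hab : a ≠ b) (hac : a ≠ c) (hbc : b ≠ c) (hkl : k ≠ l) (hnr : n ≠ r)
    (s : ℂ) (hs : 0 < s.re) :
    (∫ x : ℤ_[p],
        ((‖(x - ((a : ℤ_[p]) + d * p + k * p ^ 2)) *
            (x - ((a : ℤ_[p]) + d * p + l * p ^ 2)) ^ 3 *
            (x - ((b : ℤ_[p]) + g * p + m * p ^ 2)) *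
            (x - ((c : ℤ_[p]) + h * p + n * p ^ 2)) ^ 2 *
            (x - ((c : ℤ_[p]) + h * p + r * p ^ 2))‖ : ℝ) : ℂ) ^ s ∂μ)
      = (p : ℂ)⁻¹ * ((p : ℂ) - 3)
        + (1 - (p : ℂ)⁻¹) * (p : ℂ) ^ (-1 - s) / (1 - (p : ℂ) ^ (-1 - s))
        + (p : ℂ)⁻¹ * ((p : ℂ) - 1) * (p : ℂ) ^ (-1 - 4 * s)
        + (p : ℂ)⁻¹ * ((p : ℂ) - 1) * (p : ℂ) ^ (-1 - 3 * s)
        + (p : ℂ)⁻¹ * ((p : ℂ) - 2) * (p : ℂ) ^ (-2 - 8 * s)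
        + (1 - (p : ℂ)⁻¹) * (p : ℂ) ^ (-3 - 9 * s) / (1 - (p : ℂ) ^ (-1 - s))
        + (1 - (p : ℂ)⁻¹) * (p : ℂ) ^ (-3 - 11 * s) / (1 - (p : ℂ) ^ (-1 - 3 * s))
        + (p : ℂ)⁻¹ * ((p : ℂ) - 2) * (p : ℂ) ^ (-2 - 6 * s)
        + (1 - (p : ℂ)⁻¹) * (p : ℂ) ^ (-3 - 7 * s) / (1 - (p : ℂ) ^ (-1 - s))
        + (1 - (p : ℂ)⁻¹) * (p : ℂ) ^ (-3 - 8 * s) / (1 - (p : ℂ) ^ (-1 - 2 * s)) := by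
  have hfin : IsFiniteMeasure μ := ⟨by simp [hμ]⟩
  set α₁ : ℤ_[p] := a + d * p + k * p ^ 2 with hα₁
  set α₂ : ℤ_[p] := a + d * p + l * p ^ 2 with hα₂
  set α₃ : ℤ_[p] := b + g * p + m * p ^ 2 with hα₃
  set α₄ : ℤ_[p] := c + h * p + n * p ^ 2 with hα₄
  set α₅ : ℤ_[p] := c + h * p + r * p ^ 2 with hα₅
  have e (u v w : ℕ) : (u + v * p + w * p ^ 2 : ℤ_[p]) = u + p * (v + w * p) := by ring
  have h₁₂ : ‖α₁ - α₂‖ = ((p : ℝ)⁻¹) ^ 2 := by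
    rw [show α₁ - α₂ = (k - l) * p ^ 2 by rw [hα₁, hα₂]; ring, norm_mul,
      norm_natCast_sub_natCast_of_lt hkp hlp hkl, norm_pow, norm_p, one_mul]
  have h₄₅ : ‖α₄ - α₅‖ = ((p : ℝ)⁻¹) ^ 2 := by
    rw [show α₄ - α₅ = (n - r) * p ^ 2 by rw [hα₄, hα₅]; ring, norm_mul,
      norm_natCast_sub_natCast_of_lt hnp hrp hnr, norm_pow, norm_p, one_mul]
  have h₁₃ : ‖α₁ - α₃‖ = 1 := by
    rw [hα₁, hα₃, e, e]; exact norm_sub_eq_one_of_digit_ne hap hbp hab _ _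
  have h₁₄ : ‖α₁ - α₄‖ = 1 := by
    rw [hα₁, hα₄, e, e]; exact norm_sub_eq_one_of_digit_ne hap hcp hac _ _
  have h₁₅ : ‖α₁ - α₅‖ = 1 := by
    rw [hα₁, hα₅, e, e]; exact norm_sub_eq_one_of_digit_ne hap hcp hac _ _
  have h₃₁ : ‖α₃ - α₁‖ = 1 := by rw [norm_sub_rev, h₁₃]
  have h₃₂ : ‖α₃ - α₂‖ = 1 := by
    rw [hα₃, hα₂, e, e]; exact norm_sub_eq_one_of_digit_ne hbp hap hab.symm _ _
  have h₃₄ : ‖α₃ - α₄‖ = 1 := by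
    rw [hα₃, hα₄, e, e]; exact norm_sub_eq_one_of_digit_ne hbp hcp hbc _ _
  have h₃₅ : ‖α₃ - α₅‖ = 1 := by
    rw [hα₃, hα₅, e, e]; exact norm_sub_eq_one_of_digit_ne hbp hcp hbc _ _
  have h₄₁ : ‖α₄ - α₁‖ = 1 := by rw [norm_sub_rev, h₁₄]
  have h₄₂ : ‖α₄ - α₂‖ = 1 := by
    rw [hα₄, hα₂, e, e]; exact norm_sub_eq_one_of_digit_ne hcp hap hac.symm _ _
  have h₄₃ : ‖α₄ - α₃‖ = 1 := by rw [norm_sub_rev, h₃₄]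
  have hlt : ((p : ℝ)⁻¹) ^ 1 < 1 := by rw [pow_one]; exact inv_prime_lt_one
  have hfar {x α β : ℤ_[p]} (hx : x ∈ closedBall α (((p : ℝ)⁻¹) ^ 1)) (hαβ : ‖α - β‖ = 1) :
      ‖x - β‖ = 1 := by
    rw [mem_closedBall, dist_eq_norm] at hx
    rw [norm_sub_eq_of_lt (hαβ ▸ hx.trans_lt hlt), hαβ]
  have hnear {x α β : ℤ_[p]} (hx : ‖x - α‖ = 1) (hαβ : ‖α - β‖ = ((p : ℝ)⁻¹) ^ 2) :
      ‖x - β‖ = 1 := by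
    rw [norm_sub_eq_of_gt (α := α), hx]
    rw [hx, hαβ]
    exact (inv_prime_pow_lt one_lt_two).trans hlt
  have hd₁₃ : Disjoint (closedBall α₁ (((p : ℝ)⁻¹) ^ 1)) (closedBall α₃ (((p : ℝ)⁻¹) ^ 1)) :=
    disjoint_closedBall_of_lt (h₁₃ ▸ hlt)
  have hd₁₃₄ : Disjoint (closedBall α₁ (((p : ℝ)⁻¹) ^ 1) ∪ closedBall α₃ (((p : ℝ)⁻¹) ^ 1))
      (closedBall α₄ (((p : ℝ)⁻¹) ^ 1)) :=
    Disjoint.union_left (disjoint_closedBall_of_lt (h₁₄ ▸ hlt))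
      (disjoint_closedBall_of_lt (h₃₄ ▸ hlt))
  set φ : ℤ_[p] → ℝ := fun x ↦
    ‖(x - α₁) * (x - α₂) ^ 3 * (x - α₃) * (x - α₄) ^ 2 * (x - α₅)‖ with hφdef
  have hφ : Continuous φ := by fun_prop
  have hφx (x : ℤ_[p]) : φ x =
      ‖x - α₁‖ * ‖x - α₂‖ ^ 3 * ‖x - α₃‖ * ‖x - α₄‖ ^ 2 * ‖x - α₅‖ := by
    simp only [hφdef, norm_mul, norm_pow]
  have hint (S : Set ℤ_[p]) : IntegrableOn (fun x ↦ (φ x : ℂ) ^ s) S μ :=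
    (integrable_cpow μ hφ hs).integrableOn
  change ∫ x, (φ x : ℂ) ^ s ∂μ = _
  rw [← setIntegral_univ, setIntegral_cpow_eq_add μ hφ hs (e := 0) MeasurableSet.univ
      ((measurableSet_closedBall.union measurableSet_closedBall).union measurableSet_closedBall)
      (Set.subset_univ (closedBall α₁ (((p : ℝ)⁻¹) ^ 1) ∪ closedBall α₃ (((p : ℝ)⁻¹) ^ 1) ∪
        closedBall α₄ (((p : ℝ)⁻¹) ^ 1))) fun x _ hx ↦ ?_,
    setIntegral_union hd₁₃₄ measurableSet_closedBall (hint _) (hint _),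
    setIntegral_union hd₁₃ measurableSet_closedBall (hint _) (hint _),
    measureReal_union hd₁₃₄ measurableSet_closedBall,
    measureReal_union hd₁₃ measurableSet_closedBall,
    setIntegral_closedBall_cpow_of_pair μ hμ hφ hs (i := 1) (j := 3) h₁₂ fun x hx ↦ ?_,
    setIntegral_closedBall_cpow_of_pair μ hμ hφ hs (i := 2) (j := 1) h₄₅ fun x hx ↦ ?_,
    setIntegral_closedBall_cpow μ hμ hφ hs (C := 0) (M := 1) fun x hx ↦ ?_]
  · have hp : (p : ℂ) ≠ 0 := Nat.cast_ne_zero.2 (Fact.out : p.Prime).ne_zero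
    have key (A B : ℕ) := prime_cpow_neg_sub (p := p) (s := s) A B
    rw [show (p : ℂ) ^ (-1 - s) = (p : ℂ)⁻¹ * (p : ℂ) ^ (-s) by simpa using key 1 1,
      show (p : ℂ) ^ (-1 - 2 * s) = _ by simpa using key 1 2,
      show (p : ℂ) ^ (-1 - 3 * s) = _ by simpa using key 1 3,
      show (p : ℂ) ^ (-1 - 4 * s) = _ by simpa using key 1 4,
      show (p : ℂ) ^ (-2 - 6 * s) = _ by simpa using key 2 6,
      show (p : ℂ) ^ (-2 - 8 * s) = _ by simpa using key 2 8,
      show (p : ℂ) ^ (-3 - 7 * s) = _ by simpa using key 3 7,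
      show (p : ℂ) ^ (-3 - 8 * s) = _ by simpa using key 3 8,
      show (p : ℂ) ^ (-3 - 9 * s) = _ by simpa using key 3 9,
      show (p : ℂ) ^ (-3 - 11 * s) = _ by simpa using key 3 11]
    have huniv : μ.real Set.univ = 1 := by rw [measureReal_def, hμ, ENNReal.toReal_one]
    simp only [measureReal_closedBall μ hμ, huniv]
    have hpp : (p : ℂ)⁻¹ * p = 1 := inv_mul_cancel₀ hp
    simp only [mul_sub (p : ℂ)⁻¹ (p : ℂ), hpp]
    push_cast
    ring
  · rw [hφx, hfar hx h₃₁, hfar hx h₃₂, hfar hx h₃₄, hfar hx h₃₅]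
    ring
  · rw [hφx, hfar hx h₄₁, hfar hx h₄₂, hfar hx h₄₃]
    ring
  · rw [hφx, hfar hx h₁₃, hfar hx h₁₄, hfar hx h₁₅]
    ring
  · simp only [Set.mem_union, not_or, mem_closedBall, dist_eq_norm] at hx
    have hone {y : ℤ_[p]} (hy : ¬ ‖y‖ ≤ ((p : ℝ)⁻¹) ^ 1) : ‖y‖ = 1 := by
      simpa using norm_eq_inv_pow (n := 0) (by simpa using norm_le_one y) hy
    have hx₁ := hone hx.1.1
    have hx₄ := hone hx.2
    rw [hφx, hx₁, hone hx.1.2, hx₄, hnear hx₁ h₁₂, hnear hx₄ h₄₅]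
    norm_num
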